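/- Let N ≥ 1. With 𝒟_{M+1} denoting, for each M ≥ 0, the (M+1)×(M+1) real tridiagonal matrix with zero diagonal, superdiagonal entries i+1 and subdiagonal entries M−i+1 (0-indexed), one has for every real x: det(x·I_{N+1} + 𝒟_{N+1}) = (x − N)(x + N) · det(x·I_{N−1} + 𝒟_{N−1}), where 𝒟_{N−1} is the matrix of size (N−1) built with parameter M = N−2. -/

import Mathlib

/-- The Sylvester matrix `𝒟_{M+1}` of size `n = M + 1`: zero diagonal,
superdiagonal entries `i + 1`, subdiagonal entries `M - i + 1 = n - i` (0-indexed). -/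
def sylvesterD (n : ℕ) : Matrix (Fin n) (Fin n) ℝ :=
  Matrix.of fun i j =>
    if (j : ℕ) = (i : ℕ) + 1 then ((i : ℕ) + 1 : ℝ)
    else if (i : ℕ) = (j : ℕ) + 1 then ((n : ℝ) - (i : ℕ))
    else 0

/-- The matrix of multiplication by `1 - t ^ 2` on polynomials in the monomial basis, truncated to
size `n`. -/
def oneSubSqMatrix (n : ℕ) : Matrix (Fin n) (Fin n) ℝ :=
  Matrix.of fun i j =>
    (if (i : ℕ) = j then 1 else 0) - (if (i : ℕ) = (j : ℕ) + 2 then 1 else 0)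

/-- The matrix of the Sylvester operator of size `m + 2` in the basis
`(1 - t ^ 2) * t ^ j` (for `j < m`), `t ^ m`, `t ^ (m + 1)`. It is block upper triangular. -/
def sylvesterBlock (m : ℕ) : Matrix (Fin (m + 2)) (Fin (m + 2)) ℝ :=
  Matrix.of fun i j =>
    if (j : ℕ) = (i : ℕ) + 1 then ((i : ℕ) + 1 : ℝ)
    else if (i : ℕ) = (j : ℕ) + 1 then
      (if (i : ℕ) = m + 1 then (m : ℝ) + 1 else (m : ℝ) - (i : ℕ))
    else 0

theorem det_oneSubSqMatrix (n : ℕ) : (oneSubSqMatrix n).det = 1 := by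
  rw [Matrix.det_of_isLowerTriangular]
  · simp [oneSubSqMatrix]
  · intro i j hij
    have hij' : (i : ℕ) < j := hij
    have h₁ : (i : ℕ) ≠ j := by omega
    have h₂ : (i : ℕ) ≠ (j : ℕ) + 2 := by omega
    simp [oneSubSqMatrix, h₁, h₂]

theorem Fin.sum_mul_ite_val_eq {n : ℕ} (f : Fin n → ℝ) (c : ℕ) :
    ∑ k, f k * (if (k : ℕ) = c then 1 else 0) = if h : c < n then f ⟨c, h⟩ else 0 := by
  split_ifs with h
  · rw [Finset.sum_eq_single ⟨c, h⟩] <;> simp +contextual [Fin.ext_iff]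
  · refine Finset.sum_eq_zero fun k _ => ?_
    have : (k : ℕ) ≠ c := by omega
    simp [this]

theorem mul_oneSubSqMatrix_apply {n : ℕ} (A : Matrix (Fin n) (Fin n) ℝ) (i j : Fin n) :
    (A * oneSubSqMatrix n) i j =
      A i j - if h : (j : ℕ) + 2 < n then A i ⟨j + 2, h⟩ else 0 := by
  simp only [Matrix.mul_apply, oneSubSqMatrix, Matrix.of_apply, mul_sub, Finset.sum_sub_distrib,
    Fin.sum_mul_ite_val_eq]
  simp

theorem oneSubSqMatrix_mul_apply {n : ℕ} (B : Matrix (Fin n) (Fin n) ℝ) (i j : Fin n) :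
    (oneSubSqMatrix n * B) i j =
      B i j - if 2 ≤ (i : ℕ) then B ⟨i - 2, by omega⟩ j else 0 := by
  simp only [Matrix.mul_apply, oneSubSqMatrix, Matrix.of_apply, sub_mul, Finset.sum_sub_distrib]
  congr 1
  · simp [← Fin.ext_iff]
  · split_ifs with h
    · have (k : Fin n) : (i : ℕ) = k + 2 ↔ (⟨i - 2, by omega⟩ : Fin n) = k := by
        rw [Fin.ext_iff]
        simp only
        omega
      simp [this]
    · refine Finset.sum_eq_zero fun k _ => ?_
      have : (i : ℕ) ≠ k + 2 := by omega
      simp [this]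

theorem sylvesterD_mul_oneSubSqMatrix (m : ℕ) :
    sylvesterD (m + 2) * oneSubSqMatrix (m + 2) =
      oneSubSqMatrix (m + 2) * sylvesterBlock m := by
  ext ⟨i, hi⟩ ⟨j, hj⟩
  rw [mul_oneSubSqMatrix_apply, oneSubSqMatrix_mul_apply]
  simp only [sylvesterD, sylvesterBlock, Matrix.of_apply]
  push_cast
  by_cases h₁ : j = i + 1
  · subst h₁
    grind
  by_cases h₂ : i = j + 1
  · subst h₂
    rcases j with _ | j <;> grind
  by_cases h₃ : i = j + 3
  · subst h₃
    grind
  grind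

theorem det_smul_one_add_sylvesterBlock (m : ℕ) (x : ℝ) :
    (x • 1 + sylvesterBlock m).det =
      (x - (m + 1)) * (x + (m + 1)) * (x • 1 + sylvesterD m).det := by
  set M := x • 1 + sylvesterBlock m with hM
  rw [← Matrix.det_submatrix_equiv_self (finSumFinEquiv (m := m) (n := 2)) M,
    ← Matrix.fromBlocks_toBlocks (M.submatrix _ _)]
  have h₁₁ : (M.submatrix finSumFinEquiv finSumFinEquiv).toBlocks₁₁ = x • 1 + sylvesterD m := by
    ext i j
    have : (i : ℕ) ≠ m + 1 := by omega
    simp [hM, Matrix.toBlocks₁₁, sylvesterBlock, sylvesterD, Matrix.one_apply, Fin.ext_iff, this]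
  have h₂₁ : (M.submatrix finSumFinEquiv finSumFinEquiv).toBlocks₂₁ = 0 := by
    ext i j
    simp only [hM, Matrix.toBlocks₂₁, sylvesterBlock, Matrix.one_apply, Fin.ext_iff,
      Matrix.submatrix_apply, Matrix.add_apply, Matrix.smul_apply, Matrix.of_apply,
      finSumFinEquiv_apply_left, finSumFinEquiv_apply_right, Fin.val_castAdd, Fin.val_natAdd,
      Matrix.zero_apply, smul_eq_mul]
    fin_cases i <;> grind
  have hm : m ≠ m + 1 + 1 := by omega
  have h₂₂ : (M.submatrix finSumFinEquiv finSumFinEquiv).toBlocks₂₂ =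
      !![x, (m : ℝ) + 1; (m : ℝ) + 1, x] := by
    ext i j
    fin_cases i <;> fin_cases j <;>
      simp [hM, Matrix.toBlocks₂₂, sylvesterBlock, Matrix.one_apply, Fin.ext_iff, hm]
  rw [h₁₁, h₂₁, h₂₂, Matrix.det_fromBlocks_zero₂₁, Matrix.det_fin_two_of]
  ring

theorem sylvester_det_rec (N : ℕ) (hN : 1 ≤ N) (x : ℝ) :
    (x • (1 : Matrix (Fin (N + 1)) (Fin (N + 1)) ℝ) + sylvesterD (N + 1)).det =
      (x - (N : ℝ)) * (x + (N : ℝ)) *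
        (x • (1 : Matrix (Fin (N - 1)) (Fin (N - 1)) ℝ) + sylvesterD (N - 1)).det := by
  obtain ⟨m, rfl⟩ := Nat.exists_eq_add_of_le' hN
  have h : (x • 1 + sylvesterD (m + 2)) * oneSubSqMatrix (m + 2) =
      oneSubSqMatrix (m + 2) * (x • 1 + sylvesterBlock m) := by
    simp [add_mul, mul_add, sylvesterD_mul_oneSubSqMatrix]
  have hdet := congrArg Matrix.det h
  rw [Matrix.det_mul, Matrix.det_mul, det_oneSubSqMatrix, one_mul, mul_one,
    det_smul_one_add_sylvesterBlock] at hdet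
  simpa using hdet
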